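/- Let C be a k-coalgebra, λ = {λ_α : C → C}_{α∈G} a family of coalgebra maps (a weak G-action), and f = {f_{α,β} ∈ C*}_{α,β∈G} a family of k-linear maps such that f_{e,e} has a convolution inverse g_{e,e} and λ_e(c) = f_{e,e}(c_{(1)}) c_{(2)} g_{e,e}(c_{(3)}) for all c ∈ C. Define (C ⋊ k⟨G⟩)_α = C ⊗ k p_α, Δ_{α,β}(c ⋊ p_{αβ}) = (c_{(1)} ⋊ p_α) ⊗ (λ_α(c_{(2)}) f_{α,β}(c_{(3)}) ⋊ p_β) and ε(c ⋊ p_e) = g_{e,e}(c). Then C ⋊ k⟨G⟩ is a G-coalgebra if and only if, for all c ∈ C and α,β,γ ∈ G: (CU) f_{e,α} = f_{e,e} and f_{α,e} = f_{e,e}∘λ_α; (C) f_{β,γ}(λ_α(c_{(1)})) f_{α,βγ}(c_{(2)}) = f_{α,β}(c_{(1)}) f_{αβ,γ}(c_{(2)}); (TC) λ_β(λ_α(c_{(1)})) f_{α,β}(c_{(2)}) = f_{α,β}(c_{(1)}) λ_{αβ}(c_{(2)}). -/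

import Mathlib

open TensorProduct

universe u

/-- A `G`-group coalgebra over `k`: a family of `k`-vector spaces `C α` with
comultiplications `Δ_{α,β} : C (α*β) → C α ⊗ C β` and a counit `ε : C 1 → k`.
The comultiplication takes an explicit proof `γ = α * β` to avoid dependent casts. -/
structure GCoalgebra (k : Type u) [Field k] (G : Type u) [Group G] where
  C : G → Type u
  [acg : ∀ α, AddCommGroup (C α)]
  [mod : ∀ α, Module k (C α)]
  Δ : ∀ ⦃γ⦄ (α β : G), γ = α * β → (C γ →ₗ[k] C α ⊗[k] C β)
  ε : C 1 →ₗ[k] k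
  coassoc : ∀ ⦃δ δ₁ δ₂ : G⦄ (α β γ : G) (h₁ : δ = δ₁ * γ) (h₁' : δ₁ = α * β)
      (h₂ : δ = α * δ₂) (h₂' : δ₂ = β * γ),
      (TensorProduct.assoc k (C α) (C β) (C γ)).toLinearMap ∘ₗ
        (TensorProduct.map (Δ α β h₁') LinearMap.id) ∘ₗ Δ δ₁ γ h₁
      = (TensorProduct.map LinearMap.id (Δ β γ h₂')) ∘ₗ Δ α δ₂ h₂
  counit_right : ∀ (α : G) (h : α = α * 1),
      (TensorProduct.rid k (C α)).toLinearMap ∘ₗ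
        (TensorProduct.map LinearMap.id ε) ∘ₗ Δ α 1 h = LinearMap.id
  counit_left : ∀ (α : G) (h : α = 1 * α),
      (TensorProduct.lid k (C α)).toLinearMap ∘ₗ
        (TensorProduct.map ε LinearMap.id) ∘ₗ Δ 1 α h = LinearMap.id

attribute [instance] GCoalgebra.acg GCoalgebra.mod

variable {k : Type u} [Field k] {G : Type u} [Group G]

/-- A right `G`-`C̲`-comodule. -/
structure GComodule (Cc : GCoalgebra k G) where
  M : G → Type u
  [acg : ∀ α, AddCommGroup (M α)]
  [mod : ∀ α, Module k (M α)]
  ρ : ∀ ⦃γ⦄ (α β : G), γ = α * β → (M γ →ₗ[k] M α ⊗[k] Cc.C β)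
  counit : ∀ (α : G) (h : α = α * 1),
      (TensorProduct.rid k (M α)).toLinearMap ∘ₗ
        (TensorProduct.map LinearMap.id Cc.ε) ∘ₗ ρ α 1 h = LinearMap.id
  coassoc : ∀ ⦃δ δ₁ δ₂ : G⦄ (α β γ : G) (h₁ : δ = δ₁ * γ) (h₁' : δ₁ = α * β)
      (h₂ : δ = α * δ₂) (h₂' : δ₂ = β * γ),
      (TensorProduct.assoc k (M α) (Cc.C β) (Cc.C γ)).toLinearMap ∘ₗ
        (TensorProduct.map (ρ α β h₁') LinearMap.id) ∘ₗ ρ δ₁ γ h₁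
      = (TensorProduct.map LinearMap.id (Cc.Δ β γ h₂')) ∘ₗ ρ α δ₂ h₂

attribute [instance] GComodule.acg GComodule.mod

/-- A morphism of right `G`-`C̲`-comodules. -/
structure GComodHom {Cc : GCoalgebra k G} (M N : GComodule Cc) where
  φ : ∀ α, M.M α →ₗ[k] N.M α
  colinear : ∀ ⦃γ⦄ (α β : G) (h : γ = α * β),
      (TensorProduct.map (φ α) LinearMap.id) ∘ₗ M.ρ α β h = N.ρ α β h ∘ₗ φ γ

/-- A `G`-coalgebra is strong if all comultiplication maps are injective. -/
def GCoalgebra.Strong (Cc : GCoalgebra k G) : Prop :=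
  ∀ (α β : G), Function.Injective (Cc.Δ α β rfl)
section Convolution

variable (k : Type u) [Field k] (C : Type u) [AddCommGroup C] [Module k C]
  [Coalgebra k C]

/-- Convolution of two functionals on a coalgebra: `(f * g)(c) = f(c₁) g(c₂)`. -/
noncomputable def convF (f g : C →ₗ[k] k) : C →ₗ[k] k :=
  LinearMap.mul' k k ∘ₗ TensorProduct.map f g ∘ₗ Coalgebra.comul

/-- `convFM f T : c ↦ f(c₁) T(c₂)`. -/
noncomputable def convFM (f : C →ₗ[k] k) (T : C →ₗ[k] C) : C →ₗ[k] C :=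
  (TensorProduct.lid k C).toLinearMap ∘ₗ TensorProduct.map f T ∘ₗ Coalgebra.comul

/-- `convMF T f : c ↦ T(c₁) f(c₂)`. -/
noncomputable def convMF (T : C →ₗ[k] C) (f : C →ₗ[k] k) : C →ₗ[k] C :=
  (TensorProduct.rid k C).toLinearMap ∘ₗ TensorProduct.map T f ∘ₗ Coalgebra.comul

end Convolution

/-- The data of a crossed coproduct: a `k`-coalgebra `C`, a family of coalgebra
endomorphisms `λ_α` of `C` (a weak `G`-action), and families of functionals
`f_{α,β}, g_{α,β} ∈ C*` (`g` recording the convolution inverses of `f`). -/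
structure CrossedData (k G : Type u) [Field k] [Group G] where
  C : Type u
  [acg : AddCommGroup C]
  [mod : Module k C]
  [coalg : Coalgebra k C]
  lam : G → (C →ₗc[k] C)
  f : G → G → (C →ₗ[k] k)
  g : G → G → (C →ₗ[k] k)

attribute [instance] CrossedData.acg CrossedData.mod CrossedData.coalg

namespace CrossedData

variable {k G : Type u} [Field k] [Group G] (D : CrossedData k G)

/-- `f_{e,e}` and `g_{e,e}` are convolution inverse to each other, and
`λ_e(c) = f_{e,e}(c₁) c₂ g_{e,e}(c₃)`. -/
def IsWeakData : Prop :=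
  convF k D.C (D.f 1 1) (D.g 1 1) = Coalgebra.counit ∧
  convF k D.C (D.g 1 1) (D.f 1 1) = Coalgebra.counit ∧
  (D.lam 1).toLinearMap =
    convMF k D.C (convFM k D.C (D.f 1 1) LinearMap.id) (D.g 1 1)

/-- Condition (CU): `f_{e,α} = f_{e,e}` and `f_{α,e} = f_{e,e} ∘ λ_α`. -/
def CondCU : Prop :=
  ∀ α : G, D.f 1 α = D.f 1 1 ∧ D.f α 1 = D.f 1 1 ∘ₗ (D.lam α).toLinearMap

/-- Condition (C), the cocycle condition:
`f_{β,γ}(λ_α(c₁)) f_{α,βγ}(c₂) = f_{α,β}(c₁) f_{αβ,γ}(c₂)`. -/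
def CondC : Prop :=
  ∀ α β γ : G,
    convF k D.C (D.f β γ ∘ₗ (D.lam α).toLinearMap) (D.f α (β * γ)) =
      convF k D.C (D.f α β) (D.f (α * β) γ)

/-- Condition (TC), the twisted-commutation condition:
`λ_β(λ_α(c₁)) f_{α,β}(c₂) = f_{α,β}(c₁) λ_{αβ}(c₂)`. -/
def CondTC : Prop :=
  ∀ α β : G,
    convMF k D.C ((D.lam β).toLinearMap ∘ₗ (D.lam α).toLinearMap) (D.f α β) =
      convFM k D.C (D.f α β) (D.lam (α * β)).toLinearMap

/-- `f` is a factor set: all `f_{α,β}` are convolution invertible (with inverses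
`g_{α,β}`) and the conditions of Proposition 3.1 hold. -/
def IsFactorSet : Prop :=
  D.IsWeakData ∧
  (∀ α β : G, convF k D.C (D.f α β) (D.g α β) = Coalgebra.counit ∧
    convF k D.C (D.g α β) (D.f α β) = Coalgebra.counit) ∧
  D.CondCU ∧ D.CondC ∧ D.CondTC

/-- `f` is normalized: `f_{α,e} = f_{e,α} = ε_C`. -/
def Normalized : Prop :=
  ∀ α : G, D.f α 1 = Coalgebra.counit ∧ D.f 1 α = Coalgebra.counit

/-- The comultiplication `δ_{α,β} : C → C ⊗ C` of the crossed coproduct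
`C ⋊_f k⟨G⟩` (identifying `C ⋊ p_α` with `C`):
`δ_{α,β}(c) = c₁ ⊗ λ_α(c₂) f_{α,β}(c₃)`. -/
noncomputable def delta (α β : G) : D.C →ₗ[k] D.C ⊗[k] D.C :=
  TensorProduct.map LinearMap.id
      (convMF k D.C (D.lam α).toLinearMap (D.f α β)) ∘ₗ Coalgebra.comul

/-- The `G`-coalgebra axioms for the (constant) family `C ⋊ p_α ≅ C` with the
crossed-coproduct structure maps `δ_{α,β}` and counit `g_{e,e}`. -/
def IsGCoalgebra : Prop :=
  (∀ α β γ : G,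
    (TensorProduct.assoc k D.C D.C D.C).toLinearMap ∘ₗ
      (TensorProduct.map (D.delta α β) LinearMap.id) ∘ₗ D.delta (α * β) γ
    = (TensorProduct.map LinearMap.id (D.delta β γ)) ∘ₗ D.delta α (β * γ)) ∧
  (∀ α : G,
    (TensorProduct.rid k D.C).toLinearMap ∘ₗ
      (TensorProduct.map LinearMap.id (D.g 1 1)) ∘ₗ D.delta α 1 = LinearMap.id) ∧
  (∀ α : G,
    (TensorProduct.lid k D.C).toLinearMap ∘ₗ
      (TensorProduct.map (D.g 1 1) LinearMap.id) ∘ₗ D.delta 1 α = LinearMap.id)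

end CrossedData
namespace CrossedData

section Pairing

open LinearMap

variable {k : Type*} [Field k] {C L M N : Type*} [AddCommGroup C] [Module k C] [Coalgebra k C]
  [AddCommGroup L] [Module k L] [AddCommGroup M] [Module k M] [AddCommGroup N] [Module k N]

/-- `pair P Q : c ↦ P(c₁) ⊗ Q(c₂)`. -/
noncomputable def pair (P : C →ₗ[k] M) (Q : C →ₗ[k] N) : C →ₗ[k] M ⊗[k] N :=
  TensorProduct.map P Q ∘ₗ Coalgebra.comul

/-- `rdot T f : c ↦ T(c₁) f(c₂)`. -/
noncomputable def rdot (T : C →ₗ[k] M) (f : C →ₗ[k] k) : C →ₗ[k] M :=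
  (TensorProduct.rid k M).toLinearMap ∘ₗ pair T f

/-- `ldot f T : c ↦ f(c₁) T(c₂)`. -/
noncomputable def ldot (f : C →ₗ[k] k) (T : C →ₗ[k] M) : C →ₗ[k] M :=
  (TensorProduct.lid k M).toLinearMap ∘ₗ pair f T

theorem ldot_eq_rdot (f g : C →ₗ[k] k) : ldot f g = rdot f g := by
  unfold ldot rdot
  congr 1
  ext
  simp

theorem map_comp_pair {M' N' : Type*} [AddCommGroup M'] [Module k M'] [AddCommGroup N']
    [Module k N'] (φ : M →ₗ[k] M') (ψ : N →ₗ[k] N') (P : C →ₗ[k] M) (Q : C →ₗ[k] N) :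
    TensorProduct.map φ ψ ∘ₗ pair P Q = pair (φ ∘ₗ P) (ψ ∘ₗ Q) := by
  simp only [pair, TensorProduct.map_comp, comp_assoc]

theorem assoc_comp_pair (P : C →ₗ[k] L) (Q : C →ₗ[k] M) (R : C →ₗ[k] N) :
    (TensorProduct.assoc k L M N).toLinearMap ∘ₗ pair (pair P Q) R = pair P (pair Q R) := by
  have key : (TensorProduct.assoc k L M N).toLinearMap ∘ₗ
      TensorProduct.map (TensorProduct.map P Q) R =
      TensorProduct.map P (TensorProduct.map Q R) ∘ₗ
        (TensorProduct.assoc k C C C).toLinearMap := by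
    ext; simp
  have h₁ : pair (pair P Q) R = TensorProduct.map (TensorProduct.map P Q) R ∘ₗ
      Coalgebra.comul.rTensor C ∘ₗ Coalgebra.comul := by
    simp only [pair, rTensor, ← comp_assoc, ← TensorProduct.map_comp, comp_id]
  have h₂ : pair P (pair Q R) = TensorProduct.map P (TensorProduct.map Q R) ∘ₗ
      Coalgebra.comul.lTensor C ∘ₗ Coalgebra.comul := by
    simp only [pair, lTensor, ← comp_assoc, ← TensorProduct.map_comp, comp_id]
  rw [h₁, h₂, ← Coalgebra.coassoc, ← comp_assoc, key, comp_assoc]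

theorem pair_rdot (P : C →ₗ[k] M) (Q : C →ₗ[k] N) (f : C →ₗ[k] k) :
    pair P (rdot Q f) = rdot (pair P Q) f := by
  have key : (TensorProduct.rid k (M ⊗[k] N)).toLinearMap =
      TensorProduct.map id (TensorProduct.rid k N).toLinearMap ∘ₗ
        (TensorProduct.assoc k M N k).toLinearMap := by
    ext; simp
  rw [rdot, rdot, key, comp_assoc, assoc_comp_pair, map_comp_pair, id_comp]

theorem pair_ldot_left (f : C →ₗ[k] k) (P : C →ₗ[k] M) (Q : C →ₗ[k] N) :
    pair (ldot f P) Q = ldot f (pair P Q) := by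
  have key : (TensorProduct.lid k (M ⊗[k] N)).toLinearMap ∘ₗ
        (TensorProduct.assoc k k M N).toLinearMap =
      TensorProduct.map (TensorProduct.lid k M).toLinearMap id := by
    ext; simp
  rw [ldot, ldot, ← assoc_comp_pair, ← comp_assoc, key, map_comp_pair, id_comp]

theorem pair_rdot_left (P : C →ₗ[k] M) (f : C →ₗ[k] k) (Q : C →ₗ[k] N) :
    pair (rdot P f) Q = pair P (ldot f Q) := by
  have key : TensorProduct.map id (TensorProduct.lid k N).toLinearMap ∘ₗ
        (TensorProduct.assoc k M k N).toLinearMap =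
      TensorProduct.map (TensorProduct.rid k M).toLinearMap id := by
    ext; simp
  have h := map_comp_pair id (TensorProduct.lid k N).toLinearMap P (pair f Q)
  rw [← assoc_comp_pair, ← comp_assoc, key, map_comp_pair, id_comp, id_comp] at h
  exact h

theorem comp_rdot (φ : M →ₗ[k] N) (T : C →ₗ[k] M) (f : C →ₗ[k] k) :
    φ ∘ₗ rdot T f = rdot (φ ∘ₗ T) f := by
  have key : φ ∘ₗ (TensorProduct.rid k M).toLinearMap =
      (TensorProduct.rid k N).toLinearMap ∘ₗ TensorProduct.map φ id := by
    ext; simp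
  rw [rdot, rdot, ← comp_assoc, key, comp_assoc, map_comp_pair, id_comp]

theorem comp_ldot (φ : M →ₗ[k] N) (f : C →ₗ[k] k) (T : C →ₗ[k] M) :
    φ ∘ₗ ldot f T = ldot f (φ ∘ₗ T) := by
  have key : φ ∘ₗ (TensorProduct.lid k M).toLinearMap =
      (TensorProduct.lid k N).toLinearMap ∘ₗ TensorProduct.map id φ := by
    ext; simp
  rw [ldot, ldot, ← comp_assoc, key, comp_assoc, map_comp_pair, id_comp]

theorem rdot_rdot (T : C →ₗ[k] M) (f g : C →ₗ[k] k) :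
    rdot (rdot T f) g = rdot T (rdot f g) := by
  rw [rdot.eq_1 T (rdot f g), pair_rdot, comp_rdot, ← rdot.eq_1 T f]

theorem ldot_ldot (f g : C →ₗ[k] k) (T : C →ₗ[k] M) :
    ldot f (ldot g T) = ldot (rdot f g) T := by
  rw [← ldot_eq_rdot, ldot.eq_1 (ldot f g) T, pair_ldot_left, comp_ldot, ← ldot.eq_1 g T]

theorem rdot_ldot (f : C →ₗ[k] k) (T : C →ₗ[k] M) (g : C →ₗ[k] k) :
    rdot (ldot f T) g = ldot f (rdot T g) := by
  rw [ldot.eq_1 f (rdot T g), pair_rdot, comp_rdot, ← ldot.eq_1]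

@[simp]
theorem rdot_counit (T : C →ₗ[k] M) : rdot T Coalgebra.counit = T := by
  ext c
  have h := congrArg (TensorProduct.rid k M ∘ T.rTensor k)
    (Coalgebra.lTensor_counit_comul (R := k) c)
  simp only [Function.comp_apply, rTensor_tmul, TensorProduct.rid_tmul, one_smul] at h
  rw [← h, ← comp_apply, rTensor_comp_lTensor]
  rfl

@[simp]
theorem ldot_counit (T : C →ₗ[k] M) : ldot Coalgebra.counit T = T := by
  ext c
  have h := congrArg (TensorProduct.lid k M ∘ T.lTensor k)
    (Coalgebra.rTensor_counit_comul (R := k) c)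
  simp only [Function.comp_apply, lTensor_tmul, TensorProduct.lid_tmul, one_smul] at h
  rw [← h, ← comp_apply, lTensor_comp_rTensor]
  rfl

@[simp]
theorem counit_rdot (f : C →ₗ[k] k) : rdot Coalgebra.counit f = f := by
  rw [← ldot_eq_rdot, ldot_counit]

theorem pair_comp_coalgHom (P : C →ₗ[k] M) (Q : C →ₗ[k] N) (φ : C →ₗc[k] C) :
    pair P Q ∘ₗ φ.toLinearMap = pair (P ∘ₗ φ.toLinearMap) (Q ∘ₗ φ.toLinearMap) := by
  rw [pair, comp_assoc, ← φ.map_comp_comul, ← comp_assoc, ← TensorProduct.map_comp, pair]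

theorem rdot_comp_coalgHom (T : C →ₗ[k] M) (f : C →ₗ[k] k) (φ : C →ₗc[k] C) :
    rdot T f ∘ₗ φ.toLinearMap = rdot (T ∘ₗ φ.toLinearMap) (f ∘ₗ φ.toLinearMap) := by
  rw [rdot, comp_assoc, pair_comp_coalgHom, rdot]

theorem counit_comp_coalgHom (φ : C →ₗc[k] C) :
    Coalgebra.counit ∘ₗ φ.toLinearMap = (Coalgebra.counit : C →ₗ[k] k) :=
  CoalgHomClass.counit_comp φ

theorem lid_map_comp_pair (φ : M →ₗ[k] k) (P : C →ₗ[k] M) (Q : C →ₗ[k] N) :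
    (TensorProduct.lid k N).toLinearMap ∘ₗ TensorProduct.map φ id ∘ₗ pair P Q =
      ldot (φ ∘ₗ P) Q := by
  rw [map_comp_pair, id_comp, ldot]

theorem rid_map_comp_pair (φ : N →ₗ[k] k) (P : C →ₗ[k] M) (Q : C →ₗ[k] N) :
    (TensorProduct.rid k M).toLinearMap ∘ₗ TensorProduct.map id φ ∘ₗ pair P Q =
      rdot P (φ ∘ₗ Q) := by
  rw [map_comp_pair, id_comp, rdot]

theorem pair_id_injective {Q Q' : C →ₗ[k] N} (h : pair id Q = pair id Q') : Q = Q' := by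
  have := lid_map_comp_pair Coalgebra.counit id Q
  rw [h, lid_map_comp_pair, comp_id, ldot_counit, ldot_counit] at this
  exact this.symm

theorem rdot_id_eq_id_iff (h : C →ₗ[k] k) :
    rdot LinearMap.id h = LinearMap.id ↔ h = Coalgebra.counit := by
  refine ⟨fun H ↦ ?_, fun H ↦ by rw [H, rdot_counit]⟩
  have := congrArg (Coalgebra.counit (R := k) ∘ₗ ·) H
  simpa only [comp_rdot, comp_id, counit_rdot] using this

theorem rdot_eq_counit_iff {f g : C →ₗ[k] k} (hfg : rdot f g = Coalgebra.counit)
    (hgf : rdot g f = Coalgebra.counit) (h : C →ₗ[k] k) :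
    rdot g h = Coalgebra.counit ↔ h = f := by
  refine ⟨fun H ↦ ?_, fun H ↦ by rw [H, hgf]⟩
  rw [← counit_rdot h, ← hfg, rdot_rdot, H, rdot_counit]

end Pairing

variable {k G : Type u} [Field k] [Group G] (D : CrossedData k G)

theorem convF_eq_rdot {C : Type u} [AddCommGroup C] [Module k C] [Coalgebra k C]
    (f g : C →ₗ[k] k) : convF k C f g = rdot f g := by
  rw [convF, rdot, pair]
  congr 1
  ext
  simp

theorem convMF_eq_rdot {C : Type u} [AddCommGroup C] [Module k C] [Coalgebra k C]
    (T : C →ₗ[k] C) (f : C →ₗ[k] k) : convMF k C T f = rdot T f := rfl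

theorem convFM_eq_ldot {C : Type u} [AddCommGroup C] [Module k C] [Coalgebra k C]
    (f : C →ₗ[k] k) (T : C →ₗ[k] C) : convFM k C f T = ldot f T := rfl

theorem delta_eq_pair (α β : G) :
    D.delta α β = pair LinearMap.id (rdot (D.lam α).toLinearMap (D.f α β)) := rfl

/-- Coassociativity of `delta` with its redundant first tensor factor removed. -/
theorem coassoc_iff (α β γ : G) :
    (TensorProduct.assoc k D.C D.C D.C).toLinearMap ∘ₗ
      (TensorProduct.map (D.delta α β) LinearMap.id) ∘ₗ D.delta (α * β) γ
    = (TensorProduct.map LinearMap.id (D.delta β γ)) ∘ₗ D.delta α (β * γ) ↔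
    rdot (pair (D.lam α).toLinearMap (ldot (D.f α β) (D.lam (α * β)).toLinearMap))
      (D.f (α * β) γ) =
    rdot (pair (D.lam α).toLinearMap ((D.lam β).toLinearMap ∘ₗ (D.lam α).toLinearMap))
      (rdot (D.f β γ ∘ₗ (D.lam α).toLinearMap) (D.f α (β * γ))) := by
  have hL : pair (rdot (D.lam α).toLinearMap (D.f α β))
        (rdot (D.lam (α * β)).toLinearMap (D.f (α * β) γ)) =
      rdot (pair (D.lam α).toLinearMap (ldot (D.f α β) (D.lam (α * β)).toLinearMap))
        (D.f (α * β) γ) := by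
    rw [pair_rdot, pair_rdot_left]
  have hR : D.delta β γ ∘ₗ rdot (D.lam α).toLinearMap (D.f α (β * γ)) =
      rdot (pair (D.lam α).toLinearMap ((D.lam β).toLinearMap ∘ₗ (D.lam α).toLinearMap))
        (rdot (D.f β γ ∘ₗ (D.lam α).toLinearMap) (D.f α (β * γ))) := by
    rw [delta_eq_pair, comp_rdot, pair_comp_coalgHom, rdot_comp_coalgHom, pair_rdot,
      LinearMap.id_comp, rdot_rdot]
  rw [← hL, ← hR, D.delta_eq_pair (α * β), D.delta_eq_pair α (β * γ), map_comp_pair, map_comp_pair,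
    LinearMap.comp_id, LinearMap.id_comp, LinearMap.id_comp, D.delta_eq_pair α β, assoc_comp_pair]
  exact ⟨pair_id_injective, fun h ↦ by rw [h]⟩

variable {D}

theorem counit_right_iff (hD : D.IsWeakData) (α : G) :
    (TensorProduct.rid k D.C).toLinearMap ∘ₗ
      (TensorProduct.map LinearMap.id (D.g 1 1)) ∘ₗ D.delta α 1 = LinearMap.id ↔
    D.f α 1 = D.f 1 1 ∘ₗ (D.lam α).toLinearMap := by
  obtain ⟨hfg, hgf, -⟩ := hD
  rw [convF_eq_rdot] at hfg hgf
  rw [delta_eq_pair, rid_map_comp_pair, rdot_id_eq_id_iff, comp_rdot]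
  apply rdot_eq_counit_iff
  · rw [← rdot_comp_coalgHom, hfg, counit_comp_coalgHom]
  · rw [← rdot_comp_coalgHom, hgf, counit_comp_coalgHom]

theorem counit_left_iff (hD : D.IsWeakData) (α : G) :
    (TensorProduct.lid k D.C).toLinearMap ∘ₗ
      (TensorProduct.map (D.g 1 1) LinearMap.id) ∘ₗ D.delta 1 α = LinearMap.id ↔
    D.f 1 α = D.f 1 1 := by
  obtain ⟨hfg, hgf, hlam⟩ := hD
  rw [convF_eq_rdot] at hfg hgf
  rw [delta_eq_pair, lid_map_comp_pair, hlam, convMF_eq_rdot, convFM_eq_ldot, LinearMap.comp_id,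
    rdot_ldot, rdot_ldot, ldot_ldot, hgf, ldot_counit, rdot_rdot, rdot_id_eq_id_iff]
  exact rdot_eq_counit_iff hfg hgf _

theorem ldot_rdot_eq_of_coassoc {α β γ : G}
    (h : (TensorProduct.assoc k D.C D.C D.C).toLinearMap ∘ₗ
        (TensorProduct.map (D.delta α β) LinearMap.id) ∘ₗ D.delta (α * β) γ
      = (TensorProduct.map LinearMap.id (D.delta β γ)) ∘ₗ D.delta α (β * γ)) :
    rdot (ldot (D.f α β) (D.lam (α * β)).toLinearMap) (D.f (α * β) γ) =
      rdot ((D.lam β).toLinearMap ∘ₗ (D.lam α).toLinearMap)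
        (rdot (D.f β γ ∘ₗ (D.lam α).toLinearMap) (D.f α (β * γ))) := by
  have H := congrArg ((TensorProduct.lid k D.C).toLinearMap ∘ₗ
    TensorProduct.map (Coalgebra.counit (R := k)) LinearMap.id ∘ₗ ·)
    ((D.coassoc_iff α β γ).1 h)
  simpa only [comp_rdot, lid_map_comp_pair, counit_comp_coalgHom, ldot_counit] using H

theorem condC_of_coassoc
    (h : ∀ α β γ : G,
      (TensorProduct.assoc k D.C D.C D.C).toLinearMap ∘ₗ
        (TensorProduct.map (D.delta α β) LinearMap.id) ∘ₗ D.delta (α * β) γ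
      = (TensorProduct.map LinearMap.id (D.delta β γ)) ∘ₗ D.delta α (β * γ)) :
    D.CondC := by
  intro α β γ
  have H := congrArg (Coalgebra.counit (R := k) ∘ₗ ·) (ldot_rdot_eq_of_coassoc (h α β γ))
  simp only [comp_rdot, comp_ldot, ← LinearMap.comp_assoc, counit_comp_coalgHom, counit_rdot,
    ldot_eq_rdot, rdot_counit] at H
  rw [convF_eq_rdot, convF_eq_rdot, H]

theorem condTC_of_coassoc (hD : D.IsWeakData)
    (h : ∀ α β γ : G,
      (TensorProduct.assoc k D.C D.C D.C).toLinearMap ∘ₗ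
        (TensorProduct.map (D.delta α β) LinearMap.id) ∘ₗ D.delta (α * β) γ
      = (TensorProduct.map LinearMap.id (D.delta β γ)) ∘ₗ D.delta α (β * γ))
    (hCU : D.CondCU) : D.CondTC := by
  intro α β
  have hC := condC_of_coassoc h α β 1
  rw [convF_eq_rdot, convF_eq_rdot] at hC
  have H := ldot_rdot_eq_of_coassoc (h α β 1)
  rw [hC, ← rdot_rdot] at H
  have hinv : rdot (D.f (α * β) 1) (D.g 1 1 ∘ₗ (D.lam (α * β)).toLinearMap) =
      Coalgebra.counit := by
    rw [(hCU (α * β)).2, ← rdot_comp_coalgHom, ← convF_eq_rdot, hD.1, counit_comp_coalgHom]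
  have H' := congrArg (rdot · (D.g 1 1 ∘ₗ (D.lam (α * β)).toLinearMap)) H
  simp only [rdot_rdot _ (D.f (α * β) 1), hinv, rdot_counit] at H'
  exact H'.symm

theorem coassoc_of_conditions (hC : D.CondC) (hTC : D.CondTC) (α β γ : G) :
    (TensorProduct.assoc k D.C D.C D.C).toLinearMap ∘ₗ
      (TensorProduct.map (D.delta α β) LinearMap.id) ∘ₗ D.delta (α * β) γ
    = (TensorProduct.map LinearMap.id (D.delta β γ)) ∘ₗ D.delta α (β * γ) := by
  rw [coassoc_iff, ← convFM_eq_ldot, ← hTC α β, convMF_eq_rdot, pair_rdot, rdot_rdot,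
    ← convF_eq_rdot (D.f α β), ← hC α β γ, convF_eq_rdot]

end CrossedData

/-- **Proposition 3.1.** Let `λ` be a weak `G`-action on a coalgebra `C` and `f` a
family of functionals such that `f_{e,e}` is convolution invertible with inverse
`g_{e,e}` and `λ_e(c) = f_{e,e}(c₁) c₂ g_{e,e}(c₃)`. Then the crossed coproduct
`C ⋊ k⟨G⟩` is a `G`-coalgebra if and only if conditions (CU), (C) and (TC) hold. -/
theorem crossed_coproduct_is_GCoalgebra_iff {k G : Type u} [Field k] [Group G]
    (D : CrossedData k G) (hD : D.IsWeakData) :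
    D.IsGCoalgebra ↔ (D.CondCU ∧ D.CondC ∧ D.CondTC) := by
  constructor
  · rintro ⟨hassoc, hr, hl⟩
    have hCU : D.CondCU := fun α ↦
      ⟨(CrossedData.counit_left_iff hD α).1 (hl α), (CrossedData.counit_right_iff hD α).1 (hr α)⟩
    exact ⟨hCU, CrossedData.condC_of_coassoc hassoc, CrossedData.condTC_of_coassoc hD hassoc hCU⟩
  · rintro ⟨hCU, hC, hTC⟩
    exact ⟨CrossedData.coassoc_of_conditions hC hTC,
      fun α ↦ (CrossedData.counit_right_iff hD α).2 (hCU α).2,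
      fun α ↦ (CrossedData.counit_left_iff hD α).2 (hCU α).1⟩
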